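/- Let f : ℝ^n → ℝ be differentiable and convex with L_s-Lipschitz gradient, let x* be a minimizer of f with optimal value f*, let x ∈ ℝ^n, α > 0, and set x₊ := x − α ∇f(x). Then ‖x₊ − x*‖² − ‖x − x*‖² ≤ −2α·(f(x₊) − f*) − (α/L_s)·(1 + α L_s − (α L_s)²)·‖∇f(x)‖². -/

import Mathlib

open scoped RealInnerProductSpace

section Smooth

variable {E : Type*} [NormedAddCommGroup E] [InnerProductSpace ℝ E] [CompleteSpace E]
  {f : E → ℝ} {f' : E → E}

lemma HasGradientAt.hasDerivAt_comp_lineMap {g x v : E} {t : ℝ}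
    (h : HasGradientAt f g (x + t • v)) :
    HasDerivAt (fun s : ℝ => f (x + s • v)) ⟪g, v⟫ t := by
  have hl : HasDerivAt (fun s : ℝ => x + s • v) v t := by
    simpa using ((hasDerivAt_id t).smul_const v).const_add x
  simpa [Function.comp_def] using h.hasFDerivAt.comp_hasDerivAt t hl

/-- The first-order lower bound for a convex function. -/
lemma ConvexOn.add_inner_gradient_le (hf : ConvexOn ℝ Set.univ f) {g x : E}
    (h : HasGradientAt f g x) (y : E) : f x + ⟪g, y - x⟫ ≤ f y := by
  have hc : ConvexOn ℝ Set.univ (fun s : ℝ => f (x + s • (y - x))) := by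
    have := hf.comp_affineMap (AffineMap.lineMap x y : ℝ →ᵃ[ℝ] E)
    simpa [Function.comp_def, AffineMap.lineMap_apply, add_comm] using this
  have hd : HasDerivAt (fun s : ℝ => f (x + s • (y - x))) ⟪g, y - x⟫ 0 :=
    HasGradientAt.hasDerivAt_comp_lineMap (by simpa using h)
  have := hc.le_slope_of_hasDerivAt (Set.mem_univ 0) (Set.mem_univ 1) one_pos hd
  simp [slope_def_field] at this
  linarith

/-- The descent lemma: the quadratic upper bound for a function with Lipschitz gradient. -/
lemma le_add_inner_gradient_add_sq {L : ℝ} (hdiff : ∀ z, HasGradientAt f (f' z) z)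
    (hLip : ∀ u v, ‖f' v - f' u‖ ≤ L * ‖v - u‖) (x v : E) :
    f (x + v) ≤ f x + ⟪f' x, v⟫ + L / 2 * ‖v‖ ^ 2 := by
  have hd (t : ℝ) : HasDerivAt
      (fun s : ℝ => f (x + s • v) - s * ⟪f' x, v⟫ - s ^ 2 * (L / 2 * ‖v‖ ^ 2))
      (⟪f' (x + t • v), v⟫ - ⟪f' x, v⟫ - 2 * t * (L / 2 * ‖v‖ ^ 2)) t := by
    have h₁ := (hdiff (x + t • v)).hasDerivAt_comp_lineMap
    have h₂ := (hasDerivAt_id t).mul_const ⟪f' x, v⟫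
    have h₃ := (hasDerivAt_pow 2 t).mul_const (L / 2 * ‖v‖ ^ 2)
    exact ((h₁.sub h₂).sub h₃).congr_deriv (by simp)
  have ha := antitoneOn_of_deriv_nonpos (convex_Icc (0 : ℝ) 1)
    (fun t _ => (hd t).continuousAt.continuousWithinAt)
    (fun t _ => (hd t).differentiableAt.differentiableWithinAt)
    (fun t ht => by
      rw [interior_Icc] at ht
      rw [(hd t).deriv, ← inner_sub_left]
      have h₁ := real_inner_le_norm (f' (x + t • v) - f' x) v
      have h₂ := hLip x (x + t • v)
      rw [add_sub_cancel_left, norm_smul, Real.norm_of_nonneg ht.1.le] at h₂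
      have h₃ := mul_le_mul_of_nonneg_right h₂ (norm_nonneg v)
      linarith)
  have := ha (Set.left_mem_Icc.2 zero_le_one) (Set.right_mem_Icc.2 zero_le_one) zero_le_one
  simp at this
  linarith

/-- A smooth convex function exceeds its minimum by at most
`⟪∇f x, x - x*⟫ - ‖∇f x‖² / (2L)`. -/
lemma sub_min_add_sq_norm_gradient_le_inner {L : ℝ} (hL : 0 < L)
    (hdiff : ∀ z, HasGradientAt f (f' z) z) (hconv : ConvexOn ℝ Set.univ f)
    (hLip : ∀ u v, ‖f' v - f' u‖ ≤ L * ‖v - u‖) {xs : E} (hmin : ∀ z, f xs ≤ f z) (x : E) :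
    f x - f xs + ‖f' x‖ ^ 2 / (2 * L) ≤ ⟪f' x, x - xs⟫ := by
  have h₀ : f' xs = 0 := by
    have hz := IsLocalMin.hasFDerivAt_eq_zero (Filter.Eventually.of_forall hmin)
      (hdiff xs).hasFDerivAt
    simpa using hz
  have hu := le_add_inner_gradient_add_sq hdiff hLip xs (L⁻¹ • f' x)
  have hl := hconv.add_inner_gradient_le (hdiff x) (xs + L⁻¹ • f' x)
  rw [h₀, inner_zero_left, norm_smul, Real.norm_of_nonneg (inv_pos.2 hL).le] at hu
  rw [show xs + L⁻¹ • f' x - x = L⁻¹ • f' x - (x - xs) by abel, inner_sub_right,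
    real_inner_smul_right, real_inner_self_eq_norm_sq] at hl
  have e₁ : L / 2 * (L⁻¹ * ‖f' x‖) ^ 2 = ‖f' x‖ ^ 2 / (2 * L) := by field_simp
  have e₂ : L⁻¹ * ‖f' x‖ ^ 2 = 2 * (‖f' x‖ ^ 2 / (2 * L)) := by field_simp
  linarith

end Smooth

/-- One-step contraction estimate for gradient descent on an `Ls`-smooth convex function:
`‖x₊ - x*‖² - ‖x - x*‖² ≤ -2α(f(x₊) - f*) - (α/Ls)(1 + αLs - (αLs)²)‖∇f(x)‖²`
where `x₊ = x - α ∇f(x)`. -/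
theorem gd_one_step_contraction
    {n : ℕ} (f : EuclideanSpace ℝ (Fin n) → ℝ)
    (f' : EuclideanSpace ℝ (Fin n) → EuclideanSpace ℝ (Fin n))
    (hdiff : ∀ z, HasGradientAt f (f' z) z)
    (hconv : ConvexOn ℝ Set.univ f)
    (Ls : ℝ) (hLs : 0 < Ls)
    (hLip : ∀ u v, ‖f' v - f' u‖ ≤ Ls * ‖v - u‖)
    (xs : EuclideanSpace ℝ (Fin n)) (hmin : ∀ z, f xs ≤ f z)
    (x : EuclideanSpace ℝ (Fin n)) (α : ℝ) (hα : 0 < α)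
    (xp : EuclideanSpace ℝ (Fin n)) (hstep : xp = x - α • f' x) :
    ‖xp - xs‖ ^ 2 - ‖x - xs‖ ^ 2 ≤
      -(2 * α * (f xp - f xs)) -
        (α / Ls) * (1 + α * Ls - (α * Ls) ^ 2) * ‖f' x‖ ^ 2 := by
  subst hstep
  have hd := le_add_inner_gradient_add_sq hdiff hLip x (-(α • f' x))
  have hc := sub_min_add_sq_norm_gradient_le_inner hLs hdiff hconv hLip hmin x
  rw [← sub_eq_add_neg, inner_neg_right, real_inner_smul_right, real_inner_self_eq_norm_sq,
    norm_neg, norm_smul, Real.norm_of_nonneg hα.le] at hd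
  have hx : ‖x - α • f' x - xs‖ ^ 2 =
      ‖x - xs‖ ^ 2 - 2 * α * ⟪f' x, x - xs⟫ + α ^ 2 * ‖f' x‖ ^ 2 := by
    rw [sub_right_comm, norm_sub_sq_real, real_inner_smul_right, real_inner_comm, norm_smul,
      Real.norm_of_nonneg hα.le]
    ring
  have hr : (α / Ls) * (1 + α * Ls - (α * Ls) ^ 2) * ‖f' x‖ ^ 2 =
      2 * α * (‖f' x‖ ^ 2 / (2 * Ls)) + α ^ 2 * ‖f' x‖ ^ 2 - Ls * α ^ 3 * ‖f' x‖ ^ 2 := by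
    field_simp
  rw [hx, hr]
  have hd' := mul_le_mul_of_nonneg_left hd hα.le
  have hc' := mul_le_mul_of_nonneg_left hc hα.le
  linarith
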